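/- Let b > a ≥ 1 be integers, q = ⌊b/(a+1)⌋, r = b mod (a+1). Any lattice polygon realizing the two-opposite-stair angle sequence with stair reflex-counts b and a has area at least (a+1)(q+1)(q+2)/2 − a + r(q+2). -/

import Mathlib

/-- Cross product of two planar integer vectors. -/
def cross (d e : ℤ × ℤ) : ℤ := d.1 * e.2 - d.2 * e.1

/-- Membership in an axis-parallel lattice segment with endpoints `a`, `b`. -/
def onSeg (a b p : ℤ × ℤ) : Prop :=
  min a.1 b.1 ≤ p.1 ∧ p.1 ≤ max a.1 b.1 ∧ min a.2 b.2 ≤ p.2 ∧ p.2 ≤ max a.2 b.2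

/-- A simple rectilinear lattice polygon with `n` vertices: all edges are
axis-parallel, consecutive edges are perpendicular, and non-adjacent edges are
disjoint (adjacent edges meet only in their common endpoint). -/
structure RectPolygon (n : ℕ) where
  v : ZMod n → ℤ × ℤ
  nondeg : ∀ i, v (i + 1) ≠ v i
  axis : ∀ i, (v (i + 1)).1 = (v i).1 ∨ (v (i + 1)).2 = (v i).2
  alt : ∀ i, ((v (i + 1)).1 = (v i).1 ↔ (v (i + 2)).2 = (v (i + 1)).2)
  simple : ∀ i j : ZMod n, j ≠ i → ∀ p : ℤ × ℤ,
    onSeg (v i) (v (i + 1)) p → onSeg (v j) (v (j + 1)) p →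
    (j = i + 1 ∧ p = v j) ∨ (i = j + 1 ∧ p = v i)

namespace RectPolygon

variable {n : ℕ}

/-- Vector of edge `i` (from vertex `i` to vertex `i+1`). -/
def dvec (P : RectPolygon n) (i : ZMod n) : ℤ × ℤ := P.v (i + 1) - P.v i

/-- The turn at vertex `i` is a left (+90°, convex) turn. -/
def convexAt (P : RectPolygon n) (i : ZMod n) : Prop := 0 < cross (P.dvec (i - 1)) (P.dvec i)

/-- The turn at vertex `i` is a right (−90°, reflex) turn. -/
def reflexAt (P : RectPolygon n) (i : ZMod n) : Prop := cross (P.dvec (i - 1)) (P.dvec i) < 0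

def horiz (P : RectPolygon n) (i : ZMod n) : Prop := (P.v (i + 1)).2 = (P.v i).2

def vert (P : RectPolygon n) (i : ZMod n) : Prop := (P.v (i + 1)).1 = (P.v i).1

/-- Signed x-extent of edge `i`. -/
def sx (P : RectPolygon n) (i : ZMod n) : ℤ := (P.v (i + 1)).1 - (P.v i).1

/-- Signed y-extent of edge `i`. -/
def sy (P : RectPolygon n) (i : ZMod n) : ℤ := (P.v (i + 1)).2 - (P.v i).2

/-- Length of edge `i`. -/
def elen (P : RectPolygon n) (i : ZMod n) : ℤ :=
  |(P.v (i + 1)).1 - (P.v i).1| + |(P.v (i + 1)).2 - (P.v i).2|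

section
variable [NeZero n]

/-- Counterclockwise orientation (positive shoelace signed area). -/
def ccw (P : RectPolygon n) : Prop := 0 < ∑ i : ZMod n, cross (P.v i) (P.v (i + 1))

/-- The enclosed area of a ccw polygon (shoelace formula); for a rectilinear
lattice polygon this is the number of interior unit grid cells. -/
def area (P : RectPolygon n) : ℤ := (∑ i : ZMod n, cross (P.v i) (P.v (i + 1))) / 2

/-- Perimeter: total length of all edges. -/
def perimeter (P : RectPolygon n) : ℤ := ∑ i : ZMod n, P.elen i

def maxX (P : RectPolygon n) : ℤ := Finset.univ.sup' Finset.univ_nonempty fun i : ZMod n => (P.v i).1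
def minX (P : RectPolygon n) : ℤ := Finset.univ.inf' Finset.univ_nonempty fun i : ZMod n => (P.v i).1
def maxY (P : RectPolygon n) : ℤ := Finset.univ.sup' Finset.univ_nonempty fun i : ZMod n => (P.v i).2
def minY (P : RectPolygon n) : ℤ := Finset.univ.inf' Finset.univ_nonempty fun i : ZMod n => (P.v i).2

/-- Width of the bounding box (a single unit edge gives width 1). -/
def width (P : RectPolygon n) : ℤ := P.maxX - P.minX

/-- Height of the bounding box. -/
def height (P : RectPolygon n) : ℤ := P.maxY - P.minY

/-- Area of the bounding box. -/
def bboxArea (P : RectPolygon n) : ℤ := P.width * P.height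

end

/-- A simple rectilinear polygon is x-monotone iff the cyclic sequence of
x-directions of its horizontal edges has exactly two reversals. -/
def IsXMonotone (P : RectPolygon n) : Prop :=
  {i : ZMod n | P.horiz i ∧ P.sx i * P.sx (i + 2) < 0}.ncard = 2

def IsYMonotone (P : RectPolygon n) : Prop :=
  {i : ZMod n | P.vert i ∧ P.sy i * P.sy (i + 2) < 0}.ncard = 2

def IsXYMonotone (P : RectPolygon n) : Prop := P.IsXMonotone ∧ P.IsYMonotone

/-- In a ccw x-monotone polygon, a reflex vertex lies on the upper chain iff its
adjacent horizontal edge points leftwards. -/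
def upperReflex (P : RectPolygon n) (i : ZMod n) : Prop :=
  P.reflexAt i ∧ ((P.horiz (i - 1) ∧ P.sx (i - 1) < 0) ∨ (P.horiz i ∧ P.sx i < 0))

def lowerReflex (P : RectPolygon n) (i : ZMod n) : Prop :=
  P.reflexAt i ∧ ((P.horiz (i - 1) ∧ 0 < P.sx (i - 1)) ∨ (P.horiz i ∧ 0 < P.sx i))

/-- Number of reflex vertices on the upper chain T. -/
noncomputable def rT (P : RectPolygon n) : ℕ := {i : ZMod n | P.upperReflex i}.ncard

/-- Number of reflex vertices on the lower chain B. -/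
noncomputable def rB (P : RectPolygon n) : ℕ := {i : ZMod n | P.lowerReflex i}.ncard

end RectPolygon

/-- The block (LR)^k of an angle sequence (`true` = L, `false` = R). -/
def LRblock (k : ℕ) : List Bool := (List.replicate k [true, false]).flatten

/-- `P` realizes the angle sequence `S` via a counterclockwise boundary walk. -/
def realizes {m : ℕ} [NeZero m] (S : List Bool) (P : RectPolygon m) : Prop :=
  m = S.length ∧ P.ccw ∧ ∀ i : Fin S.length,
    ((S.get i = true) ↔ P.convexAt ((i : ℕ) : ZMod m)) ∧
    ((S.get i = false) ↔ P.reflexAt ((i : ℕ) : ZMod m))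

instance (k : ℕ) : NeZero (k + 4) := ⟨by omega⟩

/-- The angle sequence of an xy-monotone polygon with two nonempty opposite
stairs BL (with `b` reflex vertices) and TR (with `a` reflex vertices):
cyclically L (LR)^b L L (LR)^a L, i.e. four extreme edges and two stairs. -/
def twoStairSeq (a b : ℕ) : List Bool :=
  [true] ++ LRblock b ++ [true, true] ++ LRblock a ++ [true]

namespace RectPolygon

/-- The image of a polygon under the rotation by 90° about the origin. -/
def rotate {n : ℕ} (P : RectPolygon n) : RectPolygon n where
  v i := (-(P.v i).2, (P.v i).1)
  nondeg i h := P.nondeg i (by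
    simp only [Prod.mk.injEq, neg_inj] at h
    exact Prod.ext h.2 h.1)
  axis i := by
    rcases P.axis i with h | h
    · exact Or.inr h
    · exact Or.inl (by simp [h])
  alt i := by
    have h1 := P.axis i
    have h2 := P.axis (i + 1)
    have h3 := P.alt i
    have h4 := P.nondeg i
    have h5 := P.nondeg (i + 1)
    have e : i + 1 + 1 = i + 2 := by ring
    rw [e] at h2 h5
    rw [Ne, Prod.ext_iff] at h4 h5
    simp only [neg_inj]
    tauto
  simple i j hij p hi hj := by
    have := P.simple i j hij (p.2, -p.1)
      (by simp only [onSeg] at hi ⊢; omega) (by simp only [onSeg] at hj ⊢; omega)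
    rcases this with ⟨h, h'⟩ | ⟨h, h'⟩
    · exact Or.inl ⟨h, by rw [← h']; simp⟩
    · exact Or.inr ⟨h, by rw [← h']; simp⟩

variable {n : ℕ}

theorem cross_dvec_rotate (P : RectPolygon n) (i j : ZMod n) :
    cross (P.rotate.dvec i) (P.rotate.dvec j) = cross (P.dvec i) (P.dvec j) := by
  simp only [cross, dvec, rotate, Prod.fst_sub, Prod.snd_sub]
  ring

theorem sum_cross_rotate [NeZero n] (P : RectPolygon n) :
    ∑ i : ZMod n, cross (P.rotate.v i) (P.rotate.v (i + 1)) =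
      ∑ i : ZMod n, cross (P.v i) (P.v (i + 1)) := by
  refine Finset.sum_congr rfl fun i _ => ?_
  simp only [cross, rotate]
  ring

theorem area_rotate [NeZero n] (P : RectPolygon n) : P.rotate.area = P.area := by
  rw [area, area, sum_cross_rotate]

theorem realizes_rotate [NeZero n] {P : RectPolygon n} {S : List Bool} (h : realizes S P) :
    realizes S P.rotate := by
  obtain ⟨h1, h2, h3⟩ := h
  refine ⟨h1, ?_, fun i => ?_⟩
  · rwa [ccw, sum_cross_rotate]
  · simp only [convexAt, reflexAt, cross_dvec_rotate]
    exact h3 i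

/-- Edge `i` points downwards. -/
def Down (P : RectPolygon n) (i : ZMod n) : Prop :=
  (P.v (i + 1)).1 = (P.v i).1 ∧ (P.v (i + 1)).2 < (P.v i).2

/-- Some rotated copy of a polygon has its edge `i` pointing downwards. -/
theorem exists_rotate_down (P : RectPolygon n) (i : ZMod n) :
    P.Down i ∨ P.rotate.Down i ∨ P.rotate.rotate.Down i ∨ P.rotate.rotate.rotate.Down i := by
  have h1 := P.axis i
  have h2 := P.nondeg i
  rw [Ne, Prod.ext_iff] at h2
  simp only [Down, rotate]
  omega

end RectPolygon

theorem getElem?_LRblock (k i : ℕ) (hi : i < 2 * k) : (LRblock k)[i]? = some (decide (i % 2 = 0)) := by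
  induction k generalizing i with
  | zero => omega
  | succ k ih =>
    have e : LRblock (k + 1) = true :: false :: LRblock k := by
      simp [LRblock, List.replicate_succ]
    rw [e]
    match i with
    | 0 => rfl
    | 1 => rfl
    | i + 2 =>
      rw [List.getElem?_cons_succ, List.getElem?_cons_succ, ih i (by omega)]
      simp

theorem length_LRblock (k : ℕ) : (LRblock k).length = 2 * k := by
  simp [LRblock, mul_comm]

theorem getElem?_twoStairSeq (a b i : ℕ) (hi : i < 2 * (a + b) + 4) :
    (twoStairSeq a b)[i]? =
      some (decide ¬(i % 2 = 0 ∧ 0 < i ∧ (i ≤ 2 * b ∨ 2 * b + 2 < i))) := by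
  have hcons : twoStairSeq a b = true :: (LRblock b ++ true :: true :: (LRblock a ++ [true])) := by
    simp [twoStairSeq]
  rw [hcons]
  rcases i with _ | i
  · simp
  rw [List.getElem?_cons_succ]
  rcases lt_or_ge i (2 * b) with h | h
  · rw [List.getElem?_append_left (by rwa [length_LRblock]), getElem?_LRblock _ _ h, Option.some_inj, decide_eq_decide]
    omega
  rw [List.getElem?_append_right (by rwa [length_LRblock]), length_LRblock]
  obtain ⟨c, rfl⟩ := Nat.exists_eq_add_of_le h
  rw [Nat.add_sub_cancel_left]
  match c with
  | 0 => simp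
  | 1 => simp
  | c + 2 =>
    rw [List.getElem?_cons_succ, List.getElem?_cons_succ]
    rcases lt_or_ge c (2 * a) with h' | h'
    · rw [List.getElem?_append_left (by rwa [length_LRblock]), getElem?_LRblock _ _ h', Option.some_inj, decide_eq_decide]
      omega
    · obtain rfl : c = 2 * a := by omega
      rw [List.getElem?_append_right (by rw [length_LRblock]), length_LRblock,
        Nat.sub_self, List.getElem?_cons_zero, Option.some_inj, eq_comm, decide_eq_true_iff]
      omega

theorem le_of_forall_le_succ {f : ℕ → ℤ} {n : ℕ} (h : ∀ i < n, f i ≤ f (i + 1)) {i j : ℕ}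
    (hij : i ≤ j) (hj : j ≤ n) : f i ≤ f j := by
  induction j, hij using Nat.le_induction with
  | base => exact le_rfl
  | succ j _ ih => exact (ih (by omega)).trans (h j (by omega))

theorem sum_Ico_eq_sum_range_sum_Ico (g : ℤ → ℤ) {f : ℕ → ℤ} {n : ℕ}
    (h : ∀ i < n, f i ≤ f (i + 1)) :
    ∑ x ∈ Finset.Ico (f 0) (f n), g x =
      ∑ i ∈ Finset.range n, ∑ x ∈ Finset.Ico (f i) (f (i + 1)), g x := by
  induction n with
  | zero => simp
  | succ n ih =>
    rw [Finset.sum_range_succ, ← ih fun i hi => h i (by omega), ← Finset.sum_union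
      (Finset.Ico_disjoint_Ico_consecutive _ _ _), Finset.Ico_union_Ico_eq_Ico
      (le_of_forall_le_succ h (Nat.zero_le n) (by omega)) (h n (by omega))]

/-- If the corners of the lower staircase do not dominate the corners of the upper one,
the region between them is large. -/
theorem staircase_area_lower_bound {a b : ℕ} {X Y U V : ℕ → ℤ}
    (hX : ∀ j ≤ b, X j < X (j + 1)) (hY : ∀ j ≤ b, Y (j + 1) < Y j)
    (hU : ∀ i ≤ a, U (i + 1) < U i) (hV : ∀ i ≤ a, V i < V (i + 1))
    (hXU : X 0 = U (a + 1)) (hYV : Y 0 = V (a + 1)) (hXU' : X (b + 1) = U 0)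
    (hYV' : Y (b + 1) = V 0)
    (hsep : ∀ j < b, ∀ m ≤ a + 1, X (j + 1) < U m ∨ Y (j + 1) < V m) (q : ℤ) (hq : 0 ≤ q) :
    2 + 2 * b * (q + 2) - (a + 1) * (q * (q + 1)) ≤
      2 * (∑ m ∈ Finset.range (a + 1), V (m + 1) * (U m - U (m + 1)) -
        ∑ j ∈ Finset.range (b + 1), Y (j + 1) * (X (j + 1) - X j)) := by
  have U_anti {i j : ℕ} (hij : i ≤ j) (hj : j ≤ a + 1) : U j ≤ U i := by
    have := le_of_forall_le_succ (f := fun i => -U i) (n := a + 1)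
      (fun i hi => by have := hU i (by omega); omega) hij hj
    simpa using this
  have V_mono {i j : ℕ} (hij : i ≤ j) (hj : j ≤ a + 1) : V i ≤ V j :=
    le_of_forall_le_succ (fun i hi => (hV i (by omega)).le) hij hj
  have X_mono {i j : ℕ} (hij : i ≤ j) (hj : j ≤ b + 1) : X i ≤ X j :=
    le_of_forall_le_succ (fun i hi => (hX i (by omega)).le) hij hj
  -- `V (μ x)` is the height of the upper staircase over the column `[x, x + 1]`
  let μ : ℤ → ℕ := fun x => sInf {m | U m ≤ x}
  have μ_le {x : ℤ} {m : ℕ} (h : U m ≤ x) : μ x ≤ m := Nat.sInf_le h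
  have U_μ {x : ℤ} (h : X 0 ≤ x) : U (μ x) ≤ x :=
    Nat.sInf_mem (s := {m | U m ≤ x}) ⟨a + 1, by simpa [← hXU] using h⟩
  have lt_μ {x : ℤ} {m : ℕ} (h : X 0 ≤ x) (hm : m ≤ a + 1) (hx : x < U m) : m < μ x := by
    by_contra! hc
    have := U_anti hc hm
    have := U_μ h
    omega
  have μ_le' {x : ℤ} (h : X 0 ≤ x) : μ x ≤ a + 1 := μ_le (by omega)
  have μ_anti {x y : ℤ} (h : X 0 ≤ x) (hxy : x ≤ y) : μ y ≤ μ x := μ_le ((U_μ h).trans hxy)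
  have upper : ∑ m ∈ Finset.range (a + 1), V (m + 1) * (U m - U (m + 1)) =
      ∑ x ∈ Finset.Ico (X 0) (X (b + 1)), V (μ x) := by
    have h := sum_Ico_eq_sum_range_sum_Ico (fun x => V (μ x)) (f := fun i => U (a + 1 - i))
      (n := a + 1) (fun i hi => U_anti (by omega) (by omega))
    simp only [Nat.sub_zero, Nat.sub_self] at h
    rw [hXU, hXU', h, ← Finset.sum_range_reflect]
    refine Finset.sum_congr rfl fun i hi => ?_
    rw [Finset.mem_range] at hi
    have e1 : a + 1 - 1 - i + 1 = a + 1 - i := by omega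
    have e2 : a + 1 - 1 - i = a + 1 - (i + 1) := by omega
    rw [e1, e2, Finset.sum_congr rfl (g := fun _ => V (a + 1 - i)), Finset.sum_const,
      Int.card_Ico, nsmul_eq_mul, Int.toNat_of_nonneg, mul_comm]
    · exact sub_nonneg.2 (U_anti (by omega) (by omega))
    · intro x hx
      rw [Finset.mem_Ico] at hx
      have := μ_le hx.1
      have hx0 : X 0 ≤ x := by
        have := U_anti (i := a + 1 - i) (j := a + 1) (by omega) le_rfl
        omega
      have := lt_μ hx0 (by omega) hx.2
      congr 1
      omega
  have columns : ∑ j ∈ Finset.range (b + 1), (V (μ (X j)) - Y (j + 1)) ≤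
      ∑ m ∈ Finset.range (a + 1), V (m + 1) * (U m - U (m + 1)) -
        ∑ j ∈ Finset.range (b + 1), Y (j + 1) * (X (j + 1) - X j) := by
    rw [upper, sum_Ico_eq_sum_range_sum_Ico _ fun i hi => (hX i (by omega)).le,
      ← Finset.sum_sub_distrib]
    refine Finset.sum_le_sum fun j hj => ?_
    rw [Finset.mem_range] at hj
    have hlt := hX j (by omega)
    have e : ∑ x ∈ Finset.Ico (X j) (X (j + 1)), V (μ x) - Y (j + 1) * (X (j + 1) - X j) =
        ∑ x ∈ Finset.Ico (X j) (X (j + 1)), (V (μ x) - Y (j + 1)) := by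
      rw [Finset.sum_sub_distrib, Finset.sum_const, Int.card_Ico, nsmul_eq_mul,
        Int.toNat_of_nonneg (by omega), mul_comm]
    rw [e]
    refine Finset.single_le_sum (f := fun x => V (μ x) - Y (j + 1)) (fun x hx => ?_)
      (Finset.left_mem_Ico.2 hlt)
    rw [Finset.mem_Ico] at hx
    have h0 : X 0 ≤ x := (X_mono (Nat.zero_le j) (by omega)).trans hx.1
    rw [sub_nonneg]
    rcases (show j = b ∨ j < b by omega) with rfl | hjb
    · rw [hYV']
      exact V_mono (Nat.zero_le _) (μ_le' h0)
    · rcases hsep j hjb _ (μ_le' h0) with h | h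
      · have := U_μ h0
        omega
      · exact h.le
  have main : ∀ j ≤ b, ∃ l : ℤ, l ≤ V (μ (X j)) - Y (j + 1) ∧
      2 + 2 * j * (q + 2) - (a + 2 - μ (X j)) * (q * (q + 1)) + (q + 1 - l) * (q + 2 - l) ≤
        2 * ∑ i ∈ Finset.range (j + 1), (V (μ (X i)) - Y (i + 1)) := by
    intro j hj
    induction j with
    | zero =>
      have e : μ (X 0) = a + 1 := by
        have := lt_μ le_rfl (by omega) (show X 0 < U a by have := hU a le_rfl; omega)
        have := μ_le' (le_refl (X 0))
        omega
      have := hY 0 (by omega)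
      refine ⟨1, ?_, ?_⟩
      · rw [e]
        omega
      · simp only [zero_add, Finset.sum_range_one, e]
        push_cast
        nlinarith
    | succ j ih =>
      obtain ⟨l, hl, hs⟩ := ih (by omega)
      have hY1 : Y (j + 1 + 1) + 1 ≤ Y (j + 1) := hY (j + 1) hj
      have h0 : X 0 ≤ X j := X_mono (Nat.zero_le j) (by omega)
      have hlt := hX j (by omega)
      have hμ := μ_anti h0 hlt.le
      rw [Finset.sum_range_succ]
      rcases hμ.eq_or_lt with hμ | hμ
      · refine ⟨l + 1, ?_, ?_⟩
        · rw [hμ]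
          omega
        · rw [hμ]
          push_cast
          linear_combination hs + 2 * hl + 2 * hY1
      · have h2 : Y (j + 1) < V (μ (X (j + 1))) := by
          rcases hsep j (by omega) _ (μ_le' (h0.trans hlt.le)) with h | h
          · have := U_μ (h0.trans hlt.le)
            omega
          · exact h
        refine ⟨2, by omega, ?_⟩
        have h3 : 0 ≤ (q + 1 - l) * (q + 2 - l) := by
          rcases le_or_gt (q + 2) l with h | h
          · exact mul_nonneg_of_nonpos_of_nonpos (by omega) (by omega)
          · exact mul_nonneg (by omega) (by omega)
        have h4 : 0 ≤ ((μ (X j) : ℤ) - μ (X (j + 1)) - 1) * (q * (q + 1)) :=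
          mul_nonneg (by omega) (by positivity)
        push_cast
        linarith
  obtain ⟨l, hl, hs⟩ := main b le_rfl
  have h3 : 0 ≤ (q + 1 - l) * (q + 2 - l) := by
    rcases le_or_gt (q + 2) l with h | h
    · exact mul_nonneg_of_nonpos_of_nonpos (by omega) (by omega)
    · exact mul_nonneg (by omega) (by omega)
  have h4 : 1 ≤ μ (X b) :=
    lt_μ (X_mono (Nat.zero_le b) (by omega)) (by omega) (by have := hX b le_rfl; omega)
  have h5 : 0 ≤ ((μ (X b) : ℤ) - 1) * (q * (q + 1)) := mul_nonneg (by omega) (by positivity)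
  linarith

/-- Twice the signed area of a staircase, relative to the origin. -/
theorem sum_cross_staircase {p : ℕ → ℤ × ℤ} {s k : ℕ}
    (h1 : ∀ j < k, (p (s + 2 * j + 1)).1 = (p (s + 2 * j)).1)
    (h2 : ∀ j < k, (p (s + 2 * j + 1)).2 = (p (s + 2 * (j + 1))).2) :
    ∑ i ∈ Finset.range (2 * k), cross (p (s + i)) (p (s + i + 1)) =
      2 * ∑ j ∈ Finset.range k,
        (p (s + 2 * (j + 1))).2 * ((p (s + 2 * j)).1 - (p (s + 2 * (j + 1))).1) +
      ((p (s + 2 * k)).1 * (p (s + 2 * k)).2 - (p s).1 * (p s).2) := by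
  induction k with
  | zero => simp
  | succ k ih =>
    rw [show 2 * (k + 1) = 2 * k + 1 + 1 by ring, Finset.sum_range_succ, Finset.sum_range_succ,
      ih (fun j hj => h1 j (by omega)) (fun j hj => h2 j (by omega)), Finset.sum_range_succ]
    have e1 := h1 k (by omega)
    have e2 := h2 k (by omega)
    rw [show 2 * (k + 1) = 2 * k + 1 + 1 by ring] at e2 ⊢
    simp only [cross, ← add_assoc] at e1 e2 ⊢
    rw [e1, e2]
    ring

theorem two_stair_area_lower_bound_of_down {a b : ℕ} {P : RectPolygon (2 * (a + b) + 4)}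
    (hP : realizes (twoStairSeq a b) P) (hdown : P.Down 0) (q : ℤ) (hq : 0 ≤ q) :
    2 + 2 * b * (q + 2) - (a + 1) * (q * (q + 1)) ≤ 2 * P.area := by
  obtain ⟨hlen, -, hturn⟩ := hP
  let p : ℕ → ℤ × ℤ := fun k => P.v k
  have p_def (k : ℕ) : p k = P.v k := rfl
  have p_end : p (2 * b + 2 + 2 * (a + 1)) = p 0 := by
    rw [p_def, p_def]
    congr 1
    rw [show 2 * b + 2 + 2 * (a + 1) = 2 * (a + b) + 4 by ring, ZMod.natCast_self, Nat.cast_zero]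
  have axis (k : ℕ) : (p (k + 1)).1 = (p k).1 ∨ (p (k + 1)).2 = (p k).2 := by
    have := P.axis k
    simpa only [p_def, Nat.cast_succ] using this
  have turn (k : ℕ) (hk : k + 1 < 2 * (a + b) + 4) :
      if (k + 1) % 2 = 0 ∧ (k + 1 ≤ 2 * b ∨ 2 * b + 2 < k + 1)
      then cross (p (k + 1) - p k) (p (k + 2) - p (k + 1)) < 0
      else 0 < cross (p (k + 1) - p k) (p (k + 2) - p (k + 1)) := by
    have h := hturn ⟨k + 1, by omega⟩
    have hget := getElem?_twoStairSeq a b (k + 1) hk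
    rw [List.getElem?_eq_getElem (by omega), Option.some_inj] at hget
    simp only [List.get_eq_getElem, hget, RectPolygon.convexAt, RectPolygon.reflexAt,
      RectPolygon.dvec, Nat.cast_succ, add_sub_cancel_right] at h
    have e : ((k : ZMod (2 * (a + b) + 4)) + 1 + 1) = ((k + 2 : ℕ) : ZMod _) := by
      push_cast; ring
    rw [e] at h
    simp only [p_def, Nat.cast_succ] at h ⊢
    split_ifs with hc
    · exact h.2.1 (by simp; omega)
    · exact h.1.1 (by simp; omega)
  have lower : ∀ j ≤ b,
      ((p (2 * j + 1)).1 = (p (2 * j)).1 ∧ (p (2 * j + 1)).2 < (p (2 * j)).2) ∧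
      (p (2 * (j + 1))).2 = (p (2 * j + 1)).2 ∧ (p (2 * j + 1)).1 < (p (2 * (j + 1))).1 := by
    have right (j : ℕ) (hj : j ≤ b)
        (h : (p (2 * j + 1)).1 = (p (2 * j)).1 ∧ (p (2 * j + 1)).2 < (p (2 * j)).2) :
        (p (2 * (j + 1))).2 = (p (2 * j + 1)).2 ∧
          (p (2 * j + 1)).1 < (p (2 * (j + 1))).1 := by
      have ht := turn (2 * j) (by omega)
      rw [if_neg (by omega)] at ht
      have ha := axis (2 * j + 1)
      rw [show 2 * j + 1 + 1 = 2 * (j + 1) by ring] at ha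
      rw [show 2 * j + 2 = 2 * (j + 1) by ring] at ht
      simp only [cross, Prod.fst_sub, Prod.snd_sub, h.1, sub_self, zero_mul, zero_sub] at ht
      have : (p (2 * j)).1 < (p (2 * (j + 1))).1 := by nlinarith
      omega
    intro j hj
    induction j with
    | zero =>
      have h0 : (p (2 * 0 + 1)).1 = (p (2 * 0)).1 ∧ (p (2 * 0 + 1)).2 < (p (2 * 0)).2 := by
        simpa [RectPolygon.Down, p_def] using hdown
      exact ⟨h0, right 0 hj h0⟩
    | succ j ih =>
      obtain ⟨-, h⟩ := ih (by omega)
      have hd : (p (2 * (j + 1) + 1)).1 = (p (2 * (j + 1))).1 ∧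
          (p (2 * (j + 1) + 1)).2 < (p (2 * (j + 1))).2 := by
        have ht := turn (2 * j + 1) (by omega)
        rw [if_pos (by omega)] at ht
        have ha := axis (2 * (j + 1))
        rw [show 2 * j + 1 + 2 = 2 * (j + 1) + 1 by ring,
          show 2 * j + 1 + 1 = 2 * (j + 1) by ring] at ht
        simp only [cross, Prod.fst_sub, Prod.snd_sub, h.1, sub_self, zero_mul, sub_zero] at ht
        have : (p (2 * (j + 1) + 1)).2 < (p (2 * j + 1)).2 := by nlinarith
        omega
      exact ⟨hd, right _ hj hd⟩
  obtain ⟨s, hs⟩ : ∃ s, s = 2 * b + 2 := ⟨_, rfl⟩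
  have upper : ∀ i ≤ a,
      ((p (s + 2 * i + 1)).1 = (p (s + 2 * i)).1 ∧ (p (s + 2 * i)).2 < (p (s + 2 * i + 1)).2) ∧
      (p (s + 2 * (i + 1))).2 = (p (s + 2 * i + 1)).2 ∧
        (p (s + 2 * (i + 1))).1 < (p (s + 2 * i + 1)).1 := by
    have left (i : ℕ) (hi : i ≤ a) (h : (p (s + 2 * i + 1)).1 = (p (s + 2 * i)).1 ∧
          (p (s + 2 * i)).2 < (p (s + 2 * i + 1)).2) :
        (p (s + 2 * (i + 1))).2 = (p (s + 2 * i + 1)).2 ∧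
          (p (s + 2 * (i + 1))).1 < (p (s + 2 * i + 1)).1 := by
      have ht := turn (s + 2 * i) (by omega)
      rw [if_neg (by omega)] at ht
      have ha := axis (s + 2 * i + 1)
      rw [show s + 2 * i + 1 + 1 = s + 2 * (i + 1) by ring] at ha
      rw [show s + 2 * i + 2 = s + 2 * (i + 1) by ring] at ht
      simp only [cross, Prod.fst_sub, Prod.snd_sub, h.1, sub_self, zero_mul, zero_sub] at ht
      have : (p (s + 2 * (i + 1))).1 < (p (s + 2 * i)).1 := by nlinarith
      omega
    intro i hi
    induction i with
    | zero =>
      have h0 : (p (s + 2 * 0 + 1)).1 = (p (s + 2 * 0)).1 ∧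
          (p (s + 2 * 0)).2 < (p (s + 2 * 0 + 1)).2 := by
        obtain ⟨-, h⟩ := lower b le_rfl
        have ht := turn (2 * b + 1) (by omega)
        rw [if_neg (by omega)] at ht
        have ha := axis (2 * (b + 1))
        rw [show s + 2 * 0 = 2 * (b + 1) by omega]
        rw [show 2 * b + 1 + 2 = 2 * (b + 1) + 1 by ring,
          show 2 * b + 1 + 1 = 2 * (b + 1) by ring] at ht
        simp only [cross, Prod.fst_sub, Prod.snd_sub, h.1, sub_self, zero_mul, sub_zero] at ht
        have : (p (2 * b + 1)).2 < (p (2 * (b + 1) + 1)).2 := by nlinarith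
        omega
      exact ⟨h0, left 0 hi h0⟩
    | succ i ih =>
      obtain ⟨-, h⟩ := ih (by omega)
      have hd : (p (s + 2 * (i + 1) + 1)).1 = (p (s + 2 * (i + 1))).1 ∧
          (p (s + 2 * (i + 1))).2 < (p (s + 2 * (i + 1) + 1)).2 := by
        have ht := turn (s + 2 * i + 1) (by omega)
        rw [if_pos (by omega)] at ht
        have ha := axis (s + 2 * (i + 1))
        rw [show s + 2 * i + 1 + 2 = s + 2 * (i + 1) + 1 by ring,
          show s + 2 * i + 1 + 1 = s + 2 * (i + 1) by ring] at ht
        simp only [cross, Prod.fst_sub, Prod.snd_sub, h.1, sub_self, zero_mul, sub_zero] at ht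
        have : (p (s + 2 * i + 1)).2 < (p (s + 2 * (i + 1) + 1)).2 := by nlinarith
        omega
      exact ⟨hd, left _ hi hd⟩
  have disjoint (j m : ℕ) (hj : j < b) (hm : m ≤ a) (z : ℤ × ℤ)
      (h1 : onSeg (p (2 * j + 1)) (p (2 * (j + 1))) z)
      (h2 : onSeg (p (s + 2 * m)) (p (s + 2 * m + 1)) z) : False := by
    have cast_inj {k l : ℕ} (hk : k < 2 * (a + b) + 4) (hl : l < 2 * (a + b) + 4)
        (h : (k : ZMod (2 * (a + b) + 4)) = l) : k = l := by
      rwa [ZMod.natCast_eq_natCast_iff', Nat.mod_eq_of_lt hk, Nat.mod_eq_of_lt hl] at h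
    have h := P.simple ((2 * j + 1 : ℕ) : ZMod _) ((s + 2 * m : ℕ) : ZMod _)
      (fun h => by have := cast_inj (by omega) (by omega) h; omega) z
    rw [← Nat.cast_succ, ← Nat.cast_succ] at h
    rcases h h1 h2 with ⟨h, -⟩ | ⟨h, -⟩ <;>
    · have := cast_inj (by omega) (by omega) h
      omega
  have p_end' : p (s + 2 * (a + 1)) = p 0 := by rw [hs, p_end]
  have U_anti {i j : ℕ} (hij : i ≤ j) (hj : j ≤ a + 1) :
      (p (s + 2 * j)).1 ≤ (p (s + 2 * i)).1 := by
    have := le_of_forall_le_succ (f := fun i => -(p (s + 2 * i)).1) (n := a + 1)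
      (fun i hi => by have := upper i (by omega); omega) hij hj
    simpa using this
  have sep_step (j : ℕ) (hj : j < b)
      (hleft : ∀ m ≤ a + 1, (p (s + 2 * m)).2 ≤ (p (2 * (j + 1))).2 →
        (p (2 * j)).1 ≤ (p (s + 2 * m)).1) :
      ∀ m ≤ a + 1, (p (2 * (j + 1))).1 < (p (s + 2 * m)).1 ∨
        (p (2 * (j + 1))).2 < (p (s + 2 * m)).2 := by
    intro m hm
    induction hm using Nat.decreasingInduction with
    | self =>
      have h1 := le_of_forall_le_succ (f := fun i => -(p (2 * i)).2) (n := b + 1) (i := 0) (j := j)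
        (fun i hi => by have := lower i (by omega); omega) (by omega) (by omega)
      have h2 := lower j (by omega)
      simp only [mul_zero] at h1
      rw [p_end']
      omega
    | of_succ m hm ih =>
      by_contra! hc
      have hl := lower j (by omega)
      have hu := upper m (by omega)
      have := hleft m (by omega) hc.2
      exact disjoint j m hj (by omega) ((p (s + 2 * m)).1, (p (2 * (j + 1))).2)
        (by simp only [onSeg]; omega) (by simp only [onSeg]; omega)
  have sep : ∀ j < b, ∀ m ≤ a + 1, (p (2 * (j + 1))).1 < (p (s + 2 * m)).1 ∨
      (p (2 * (j + 1))).2 < (p (s + 2 * m)).2 := by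
    intro j hj
    induction j with
    | zero =>
      refine sep_step 0 hj fun m hm _ => ?_
      have := U_anti hm le_rfl
      rwa [p_end'] at this
    | succ j ih =>
      refine sep_step (j + 1) hj fun m hm hV => ?_
      have := lower (j + 1) (by omega)
      have := ih (by omega) m hm
      omega
  have hsum : ∑ i : ZMod (2 * (a + b) + 4), cross (P.v i) (P.v (i + 1)) =
      ∑ i ∈ Finset.range (2 * (a + b) + 4), cross (p i) (p (i + 1)) := by
    refine Finset.sum_nbij' ZMod.val (fun k : ℕ => (k : ZMod _)) ?_ ?_ ?_ ?_ ?_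
    · exact fun i _ => Finset.mem_range.2 (ZMod.val_lt i)
    · exact fun i _ => Finset.mem_univ _
    · exact fun i _ => ZMod.natCast_zmod_val i
    · exact fun i hi => ZMod.val_cast_of_lt (Finset.mem_range.1 hi)
    · exact fun i _ => by simp [p_def]
  have h1 := sum_cross_staircase (p := p) (s := 0) (k := b + 1)
    (fun j hj => by rw [zero_add]; exact (lower j (by omega)).1.1)
    (fun j hj => by simp only [zero_add]; exact (lower j (by omega)).2.1.symm)
  have h2 := sum_cross_staircase (p := p) (s := s) (k := a + 1)
    (fun j hj => (upper j (by omega)).1.1) (fun j hj => (upper j (by omega)).2.1.symm)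
  have hsplit : ∑ i ∈ Finset.range (2 * (a + b) + 4), cross (p i) (p (i + 1)) =
      ∑ i ∈ Finset.range s, cross (p i) (p (i + 1)) +
        ∑ i ∈ Finset.range (2 * (a + 1)), cross (p (s + i)) (p (s + i + 1)) := by
    rw [show 2 * (a + b) + 4 = s + 2 * (a + 1) by omega, Finset.sum_range_add]
  simp only [zero_add] at h1
  rw [show 2 * (b + 1) = s by omega] at h1
  rw [hsplit, h1, h2, p_end'] at hsum
  have hmain := staircase_area_lower_bound (a := a) (b := b) (X := fun j => (p (2 * j)).1)
    (Y := fun j => (p (2 * j)).2) (U := fun i => (p (s + 2 * i)).1)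
    (V := fun i => (p (s + 2 * i)).2)
    (fun j hj => by have := lower j hj; omega)
    (fun j hj => by have := lower j hj; omega)
    (fun i hi => by have := upper i hi; omega)
    (fun i hi => by have := upper i hi; omega)
    (by simp only [p_end', mul_zero]) (by simp only [p_end', mul_zero])
    (by simp only [mul_zero, add_zero, hs, mul_add, mul_one])
    (by simp only [mul_zero, add_zero, hs, mul_add, mul_one]) sep q hq
  have hneg : ∑ j ∈ Finset.range (b + 1),
      (p (2 * (j + 1))).2 * ((p (2 * j)).1 - (p (2 * (j + 1))).1) =
      -∑ j ∈ Finset.range (b + 1),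
        (p (2 * (j + 1))).2 * ((p (2 * (j + 1))).1 - (p (2 * j)).1) := by
    rw [← Finset.sum_neg_distrib]
    exact Finset.sum_congr rfl fun j _ => by ring
  rw [hneg] at hsum
  rw [RectPolygon.area, hsum]
  omega

/-- Lower bound: for `b > a ≥ 1`, with `q = ⌊b/(a+1)⌋` and `r = b mod (a+1)`,
any lattice polygon realizing the two-opposite-stair angle sequence with stair
reflex-counts `b` and `a` has area at least `(a+1)(q+1)(q+2)/2 − a + r(q+2)`. -/
theorem two_stair_area_lower_bound (a b : ℕ) (ha : 1 ≤ a) (hab : a < b)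
    (P : RectPolygon (2 * (a + b) + 4)) (hP : realizes (twoStairSeq a b) P) :
    let q : ℕ := b / (a + 1)
    let r : ℕ := b % (a + 1)
    ((a : ℤ) + 1) * (q + 1) * (q + 2) / 2 - a + r * (q + 2) ≤ P.area := by
  have key : ∀ q : ℤ, 0 ≤ q →
      2 + 2 * b * (q + 2) - (a + 1) * (q * (q + 1)) ≤ 2 * P.area := by
    intro q hq
    have h1 := RectPolygon.realizes_rotate hP
    have h2 := RectPolygon.realizes_rotate h1
    rcases P.exists_rotate_down 0 with h | h | h | h
    · exact two_stair_area_lower_bound_of_down hP h q hq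
    · simpa only [RectPolygon.area_rotate] using two_stair_area_lower_bound_of_down h1 h q hq
    · simpa only [RectPolygon.area_rotate] using two_stair_area_lower_bound_of_down h2 h q hq
    · simpa only [RectPolygon.area_rotate] using
        two_stair_area_lower_bound_of_down (RectPolygon.realizes_rotate h2) h q hq
  intro q r
  have hdiv : (b : ℤ) = (a + 1) * q + r := by exact_mod_cast (Nat.div_add_mod b (a + 1)).symm
  have hk := key q (by positivity)
  have hz := Int.ediv_mul_le (((a : ℤ) + 1) * (q + 1) * (q + 2)) (b := 2) (by norm_num)
  rw [hdiv] at hk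
  linarith
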